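/- Let F : (0, 1] → [0, 1] be the Farey map, F(x) := x/(1−x) for 0 < x ≤ 1/2 and F(x) := 1/x − 1 for 1/2 ≤ x ≤ 1. Then the σ-finite Borel measure on (0, 1] with density x ↦ 1/x with respect to Lebesgue measure is F-invariant (it is an infinite invariant measure): for every Borel set A ⊆ (0, 1], the measure of F^{-1}(A) equals the measure of A. -/

import Mathlib

open MeasureTheory

/-- The Farey map: `F(x) = x/(1−x)` for `x ≤ 1/2` and `F(x) = 1/x − 1` for `x > 1/2`
(the branches agree at `x = 1/2`). -/
noncomputable def fareyMap (x : ℝ) : ℝ :=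
  if x ≤ 1 / 2 then x / (1 - x) else 1 / x - 1

/-- The σ-finite measure on `(0, 1]` with density `x ↦ 1/x` w.r.t. Lebesgue measure. -/
noncomputable def fareyMeasure : Measure ℝ :=
  (volume.restrict (Set.Ioc (0 : ℝ) 1)).withDensity
    (fun x => ENNReal.ofReal (1 / x))

theorem farey_apply (S : Set ℝ) (hS : MeasurableSet S) (h : S ⊆ Set.Ioc (0 : ℝ) 1) :
    fareyMeasure S = ∫⁻ x in S, ENNReal.ofReal (1 / x) := by
  rw [fareyMeasure, withDensity_apply _ hS, Measure.restrict_restrict hS,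
    Set.inter_eq_left.mpr h]

theorem farey_measurable : Measurable fareyMap := by
  unfold fareyMap
  refine Measurable.ite measurableSet_Iic ?_ ?_ <;> fun_prop

theorem farey_preimage (A : Set ℝ) (hA : A ⊆ Set.Ioc (0 : ℝ) 1) :
    fareyMap ⁻¹' A ∩ Set.Ioc (0 : ℝ) 1 =
      (fun y : ℝ => y / (1 + y)) '' A ∪ (fun y : ℝ => 1 / (1 + y)) '' (A \ {1}) := by
  ext x
  simp only [Set.mem_inter_iff, Set.mem_preimage, Set.mem_union, Set.mem_image, Set.mem_Ioc,
    Set.mem_sdiff, Set.mem_singleton_iff]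
  constructor
  · rintro ⟨hx, h0, h1⟩
    unfold fareyMap at hx
    split_ifs at hx with h
    · left
      refine ⟨_, hx, ?_⟩
      have : (1 - x) ≠ 0 := by linarith
      have h2 : 1 + x / (1 - x) = 1 / (1 - x) := by field_simp; ring
      rw [h2]; field_simp
    · right
      refine ⟨_, ⟨hx, ?_⟩, ?_⟩
      · intro h2
        have h3 : 1 / x = 2 := by linarith
        rw [div_eq_iff h0.ne'] at h3
        apply h; linarith
      · simp
  · rintro (⟨y, hy, rfl⟩ | ⟨y, ⟨hy, hne⟩, rfl⟩)
    · obtain ⟨h0, h1⟩ := hA hy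
      have hp : 0 < 1 + y := by linarith
      refine ⟨?_, by positivity, by rw [div_le_one hp]; linarith⟩
      unfold fareyMap
      rw [if_pos (by rw [div_le_div_iff₀ hp (by norm_num)]; linarith)]
      have h2 : 1 - y / (1 + y) = 1 / (1 + y) := by field_simp; ring
      rw [h2]
      convert hy using 1
      field_simp
    · obtain ⟨h0, h1⟩ := hA hy
      have hlt : y < 1 := lt_of_le_of_ne h1 hne
      have hp : 0 < 1 + y := by linarith
      refine ⟨?_, by positivity, by rw [div_le_one hp]; linarith⟩
      unfold fareyMap
      rw [if_neg (by rw [not_le, div_lt_div_iff₀ (by norm_num) hp]; linarith)]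
      simpa using hy

theorem stmt_16 :
    ∀ A : Set ℝ, MeasurableSet A → A ⊆ Set.Ioc (0 : ℝ) 1 →
      fareyMeasure (fareyMap ⁻¹' A) = fareyMeasure A := by
  intro A hA hsub
  have hpos : ∀ y ∈ A, 0 < y := fun y hy => (hsub hy).1
  have hB : MeasurableSet (A \ {1}) := hA.diff (measurableSet_singleton 1)
  have hd1 : ∀ y ∈ A, HasDerivWithinAt (fun y : ℝ => y / (1 + y)) (1 / (1 + y) ^ 2) A y := by
    intro y hy
    have h0 := hpos y hy
    have := ((hasDerivAt_id y).div ((hasDerivAt_id y).const_add 1)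
      (by simp only [id]; linarith)).hasDerivWithinAt (s := A)
    have e : 1 / (1 + y) ^ 2 = (1 * (1 + id y) - id y * 1) / (1 + id y) ^ 2 := by simp
    rw [e]
    exact this
  have hd2 : ∀ y ∈ A \ {1}, HasDerivWithinAt (fun y : ℝ => 1 / (1 + y)) (-1 / (1 + y) ^ 2)
      (A \ {1}) y := by
    intro y hy
    have h0 := hpos y hy.1
    have := ((hasDerivAt_const y (1 : ℝ)).div ((hasDerivAt_id y).const_add 1)
      (by simp only [id]; linarith)).hasDerivWithinAt (s := A \ {1})
    have e : -1 / (1 + y) ^ 2 = (0 * (1 + id y) - 1 * 1) / (1 + id y) ^ 2 := by simp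
    rw [e]
    exact this
  have hi1 : Set.InjOn (fun y : ℝ => y / (1 + y)) A := by
    intro a ha b hb h
    have h1 := hpos a ha
    have h2 := hpos b hb
    simp only at h
    rw [div_eq_div_iff (by linarith) (by linarith)] at h
    linarith
  have hi2 : Set.InjOn (fun y : ℝ => 1 / (1 + y)) (A \ {1}) := by
    intro a ha b hb h
    have h1 := hpos a ha.1
    have h2 := hpos b hb.1
    simp only at h
    rw [div_eq_div_iff (by linarith) (by linarith)] at h
    linarith
  have hpre : MeasurableSet (fareyMap ⁻¹' A ∩ Set.Ioc (0 : ℝ) 1) :=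
    (farey_measurable hA).inter measurableSet_Ioc
  have e0 : fareyMeasure (fareyMap ⁻¹' A) = fareyMeasure (fareyMap ⁻¹' A ∩ Set.Ioc (0 : ℝ) 1) := by
    rw [farey_apply _ hpre Set.inter_subset_right, fareyMeasure,
      withDensity_apply _ (farey_measurable hA), Measure.restrict_restrict (farey_measurable hA)]
  have hm2 : MeasurableSet ((fun y : ℝ => 1 / (1 + y)) '' (A \ {1})) :=
    hB.image_of_measurable_injOn (by fun_prop) hi2
  have hdisj : Disjoint ((fun y : ℝ => y / (1 + y)) '' A)
      ((fun y : ℝ => 1 / (1 + y)) '' (A \ {1})) := by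
    rw [Set.disjoint_left]
    rintro _ ⟨a, ha, rfl⟩ ⟨b, ⟨hb, hne⟩, h⟩
    obtain ⟨h1, h2⟩ := hsub ha
    obtain ⟨h3, h4⟩ := hsub hb
    have hlt : b < 1 := lt_of_le_of_ne h4 hne
    simp only at h
    rw [div_eq_div_iff (by linarith) (by linarith)] at h
    nlinarith
  rw [e0, farey_apply _ hpre Set.inter_subset_right, farey_preimage A hsub,
    lintegral_union hm2 hdisj, lintegral_image_eq_lintegral_abs_deriv_mul hA hd1 hi1,
    lintegral_image_eq_lintegral_abs_deriv_mul hB hd2 hi2, farey_apply A hA hsub]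
  have hae : (A \ {1} : Set ℝ) =ᵐ[volume] A := sdiff_null_ae_eq_self (by simp)
  rw [Measure.restrict_congr_set hae, ← lintegral_add_left (by fun_prop)]
  refine setLIntegral_congr_fun hA fun y hy => ?_
  have h0 := hpos y hy
  have hp : 0 < 1 + y := by linarith
  rw [← ENNReal.ofReal_mul (abs_nonneg _), ← ENNReal.ofReal_mul (abs_nonneg _),
    ← ENNReal.ofReal_add (by positivity) (by positivity)]
  congr 1
  rw [neg_div, abs_neg, abs_of_pos (by positivity)]
  field_simp
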